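/- arXiv:1906.05413 — 2 statements merged into one kernel-verified Lean document; each statement's English description precedes it below -/
import Mathlib

section
/- Let A be a real symmetric n×n matrix with nonnegative entries and at most one positive eigenvalue. Then for every α with 0 ≤ α ≤ 1, the entrywise power A^{∘α} with entries A_{ij}^α also has at most one positive eigenvalue. -/
open Finset

open Matrix in
theorem Matrix.IsHermitian.dotProduct_mulVec_eq_sum_eigenvalues {ι : Type*} [Fintype ι]
    [DecidableEq ι] {A : Matrix ι ι ℝ} (hA : A.IsHermitian) (x : ι → ℝ) :
    x ⬝ᵥ A *ᵥ x = ∑ i, hA.eigenvalues i * ((hA.eigenvectorBasis i).ofLp ⬝ᵥ x) ^ 2 := by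
  have h := hA.eigenvectorBasis.sum_inner_mul_inner (WithLp.toLp 2 x) (WithLp.toLp 2 (A *ᵥ x))
  simp only [EuclideanSpace.inner_eq_star_dotProduct, star_trivial] at h
  rw [dotProduct_comm, ← h]
  refine Finset.sum_congr rfl fun i _ ↦ ?_
  have hT : Aᵀ = A := isHermitian_iff_isSymm.1 hA
  have : (A *ᵥ x) ⬝ᵥ (hA.eigenvectorBasis i).ofLp
      = hA.eigenvalues i * ((hA.eigenvectorBasis i).ofLp ⬝ᵥ x) := by
    rw [dotProduct_comm, dotProduct_mulVec, ← mulVec_transpose, hT, hA.mulVec_eigenvectorBasis,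
      smul_dotProduct, smul_eq_mul]
  rw [this]
  ring

open Matrix in
theorem Matrix.IsHermitian.card_pos_eigenvalues_le_one_iff {ι : Type*} [Fintype ι]
    [DecidableEq ι] {A : Matrix ι ι ℝ} (hA : A.IsHermitian) :
    (univ.filter fun i ↦ 0 < hA.eigenvalues i).card ≤ 1 ↔
      ∃ u : ι → ℝ, ∀ x, u ⬝ᵥ x = 0 → x ⬝ᵥ A *ᵥ x ≤ 0 := by
  rw [Finset.card_le_one]
  simp only [mem_filter, mem_univ, true_and]
  constructor
  · intro h
    by_cases hk : ∃ k, 0 < hA.eigenvalues k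
    · obtain ⟨k, hk⟩ := hk
      refine ⟨(hA.eigenvectorBasis k).ofLp, fun x hx ↦ ?_⟩
      rw [hA.dotProduct_mulVec_eq_sum_eigenvalues]
      refine Finset.sum_nonpos fun i _ ↦ ?_
      by_cases hi : 0 < hA.eigenvalues i
      · simp [h i hi k hk, hx]
      · exact mul_nonpos_of_nonpos_of_nonneg (not_lt.1 hi) (sq_nonneg _)
    · push Not at hk
      refine ⟨0, fun x _ ↦ ?_⟩
      rw [hA.dotProduct_mulVec_eq_sum_eigenvalues]
      exact Finset.sum_nonpos fun i _ ↦ mul_nonpos_of_nonpos_of_nonneg (hk i) (sq_nonneg _)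
  · rintro ⟨u, hu⟩ i hi j hj
    by_contra hij
    set v := fun i ↦ (hA.eigenvectorBasis i).ofLp with hv
    have horth (k l) : v k ⬝ᵥ v l = if k = l then 1 else 0 := by
      have := orthonormal_iff_ite.1 hA.eigenvectorBasis.orthonormal l k
      rw [EuclideanSpace.inner_eq_star_dotProduct] at this
      simpa [hv, eq_comm] using this
    have hform (a b : ℝ) (h : a * (u ⬝ᵥ v i) + b * (u ⬝ᵥ v j) = 0) :
        hA.eigenvalues i * a ^ 2 + hA.eigenvalues j * b ^ 2 ≤ 0 := by
      have := hu (a • v i + b • v j) (by simpa [dotProduct_add] using h)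
      have hQ (k) : A *ᵥ v k = hA.eigenvalues k • v k := hA.mulVec_eigenvectorBasis k
      simp only [mulVec_add, mulVec_smul, hQ, dotProduct_add, add_dotProduct, dotProduct_smul,
        smul_dotProduct, horth, hij, Ne.symm hij, if_true, if_false, smul_eq_mul] at this
      linarith
    have h₁ := hform (u ⬝ᵥ v j) (-(u ⬝ᵥ v i)) (by ring)
    by_cases hi0 : u ⬝ᵥ v i = 0
    · have := hform 1 0 (by simp [hi0])
      linarith
    · nlinarith [mul_pos hj (pow_pos (abs_pos.2 hi0) 2), sq_abs (u ⬝ᵥ v i),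
        mul_nonneg hi.le (sq_nonneg (u ⬝ᵥ v j))]

open Matrix in
/-- The reverse Cauchy-Schwarz inequality. -/
theorem Matrix.IsHermitian.mul_le_sq_of_nonpos_of_dotProduct_eq_zero {ι : Type*} [Fintype ι]
    {A : Matrix ι ι ℝ} (hA : A.IsHermitian) {u : ι → ℝ}
    (hu : ∀ x, u ⬝ᵥ x = 0 → x ⬝ᵥ A *ᵥ x ≤ 0) (v : ι → ℝ) {w : ι → ℝ} (hw : 0 < w ⬝ᵥ A *ᵥ w) :
    (v ⬝ᵥ A *ᵥ v) * (w ⬝ᵥ A *ᵥ w) ≤ (v ⬝ᵥ A *ᵥ w) ^ 2 := by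
  have hT : Aᵀ = A := isHermitian_iff_isSymm.1 hA
  have hsymm : w ⬝ᵥ A *ᵥ v = v ⬝ᵥ A *ᵥ w := by
    rw [dotProduct_mulVec, ← mulVec_transpose, hT, dotProduct_comm]
  have ha : u ⬝ᵥ w ≠ 0 := fun h ↦ (hu w h).not_gt hw
  have h := hu ((u ⬝ᵥ w) • v - (u ⬝ᵥ v) • w) (by simp [dotProduct_sub]; ring)
  simp only [mulVec_sub, mulVec_smul, dotProduct_sub, sub_dotProduct, dotProduct_smul,
    smul_dotProduct, smul_eq_mul, hsymm] at h
  have ha2 : 0 < (u ⬝ᵥ w) ^ 2 := by positivity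
  refine le_of_mul_le_mul_left ?_ ha2
  nlinarith [mul_le_mul_of_nonneg_right h hw.le,
    sq_nonneg ((u ⬝ᵥ w) * (v ⬝ᵥ A *ᵥ w) - (u ⬝ᵥ v) * (w ⬝ᵥ A *ᵥ w))]

theorem Ring.succ_mul_choose_succ (a : ℝ) (n : ℕ) :
    (n + 1) * Ring.choose a (n + 1) = (a - n) * Ring.choose a n := by
  rw [Ring.choose_eq_smul, Ring.choose_eq_smul, descPochhammer_succ_right,
    Polynomial.smeval_mul, Nat.factorial_succ]
  have : (n.factorial : ℝ) ≠ 0 := by positivity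
  simp [Polynomial.smeval_sub, Polynomial.smeval_X, Polynomial.smeval_natCast]
  field_simp

theorem Real.exists_hasSum_one_sub_one_sub_rpow {α : ℝ} (h0 : 0 ≤ α) (h1 : α ≤ 1) :
    ∃ c : ℕ → ℝ, (∀ n, 0 ≤ c n) ∧
      ∀ t : ℝ, |t| < 1 → HasSum (fun n ↦ c n * t ^ n) (1 - (1 - t) ^ α) := by
  refine ⟨fun n ↦ (if n = 0 then 1 else 0) - (-1) ^ n * Ring.choose α n, fun n ↦ ?_,
    fun t ht ↦ ?_⟩
  · rcases n with _ | n
    · simp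
    · suffices (-1) ^ (n + 1) * Ring.choose α (n + 1) ≤ 0 by simpa using this
      induction n with
      | zero => simpa using h0
      | succ n ih =>
        have h := Ring.succ_mul_choose_succ α (n + 1)
        push_cast at h
        have hn : (0 : ℝ) < n + 1 + 1 := by positivity
        refine nonpos_of_mul_nonpos_right ?_ hn
        have : ((n : ℝ) + 1 + 1) * ((-1) ^ (n + 1 + 1) * Ring.choose α (n + 1 + 1))
            = (n + 1 - α) * ((-1) ^ (n + 1) * Ring.choose α (n + 1)) := by
          rw [pow_succ]
          linear_combination (-(-1 : ℝ) ^ (n + 1)) * h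
        rw [this]
        have : (0 : ℝ) ≤ n := by positivity
        exact mul_nonpos_of_nonneg_of_nonpos (by linarith) ih
  · have h := (Real.one_add_rpow_hasFPowerSeriesOnBall_zero (a := α)).hasSum
      (y := -t) (by simpa [Metric.mem_eball, edist_dist] using ht)
    have h' := (hasSum_ite_eq 0 (1 : ℝ)).sub h
    simp only [binomialSeries_apply] at h'
    rw [show 1 - (1 - t) ^ α = 1 - (1 + (0 + -t)) ^ α by simp [sub_eq_add_neg]]
    refine h'.congr_fun fun n ↦ ?_
    rcases n with _ | n
    · simp
    · simp [neg_pow t]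
      ring

open Matrix in
theorem Matrix.PosSemidef.sum_one_sub_one_sub_rpow_nonneg {ι : Type*} [Fintype ι] {T : Matrix ι ι ℝ}
    (hT : T.PosSemidef) (hT1 : ∀ i j, |T i j| ≤ 1) {α : ℝ} (h0 : 0 < α) (h1 : α ≤ 1) (x : ι → ℝ) :
    0 ≤ ∑ i, ∑ j, x i * x j * (1 - (1 - T i j) ^ α) := by
  obtain ⟨c, hc, hsum⟩ := Real.exists_hasSum_one_sub_one_sub_rpow h0.le h1
  have hpow (n : ℕ) : (T.map (· ^ n)).PosSemidef := by
    induction n with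
    | zero =>
      convert Matrix.posSemidef_vecMulVec_self_star (1 : ι → ℝ) using 1
      ext i j
      simp [vecMulVec_apply]
    | succ n ih =>
      have : (T.map fun t ↦ t ^ (n + 1)) = (T.map fun t ↦ t ^ n) ⊙ T := by
        ext i j
        simp [pow_succ]
      exact this ▸ ih.hadamard hT
  have hq (q : ℝ) (hq0 : 0 ≤ q) (hq1 : q < 1) :
      0 ≤ ∑ i, ∑ j, x i * x j * (1 - (1 - q * T i j) ^ α) := by
    have hs : HasSum (fun n ↦ ∑ i, ∑ j, x i * x j * (c n * (q * T i j) ^ n))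
        (∑ i, ∑ j, x i * x j * (1 - (1 - q * T i j) ^ α)) := by
      refine hasSum_sum fun i _ ↦ hasSum_sum fun j _ ↦ (hsum _ ?_).mul_left _
      rw [abs_mul, abs_of_nonneg hq0]
      exact (mul_le_of_le_one_right hq0 (hT1 i j)).trans_lt hq1
    refine hs.nonneg fun n ↦ ?_
    have := mul_nonneg (mul_nonneg (hc n) (pow_nonneg hq0 n))
      ((hpow n).dotProduct_mulVec_nonneg x)
    convert this using 1
    simp only [dotProduct, mulVec, mul_sum, star_trivial, map_apply]
    exact sum_congr rfl fun i _ ↦ sum_congr rfl fun j _ ↦ by ring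
  have hcont : Continuous fun q : ℝ ↦ ∑ i, ∑ j, x i * x j * (1 - (1 - q * T i j) ^ α) := by
    refine continuous_finsetSum _ fun i _ ↦ continuous_finsetSum _ fun j _ ↦ ?_
    exact continuous_const.mul (continuous_const.sub
      ((by fun_prop : Continuous fun q : ℝ ↦ 1 - q * T i j).rpow_const fun _ ↦ Or.inr h0.le))
  have hlim := (hcont.tendsto 1).mono_left (nhdsWithin_le_nhds (s := Set.Iio 1))
  simp only [one_mul] at hlim
  refine ge_of_tendsto hlim ?_
  filter_upwards [Ioo_mem_nhdsLT (zero_lt_one' ℝ)] with q hq' using hq q hq'.1.le hq'.2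

open Matrix in
theorem Matrix.IsHermitian.exists_forall_dotProduct_rpow_mulVec_nonpos {ι : Type*} [Fintype ι]
    {A : Matrix ι ι ℝ} (hA : A.IsHermitian) (hpos : ∀ i j, 0 ≤ A i j) {u : ι → ℝ}
    (hu : ∀ x, u ⬝ᵥ x = 0 → x ⬝ᵥ A *ᵥ x ≤ 0) {α : ℝ} (h0 : 0 < α) (h1 : α ≤ 1) :
    ∃ w : ι → ℝ, ∀ x, w ⬝ᵥ x = 0 → x ⬝ᵥ (of fun i j ↦ A i j ^ α : Matrix ι ι ℝ) *ᵥ x ≤ 0 := by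
  classical
  set r : ι → ℝ := A *ᵥ 1 with hr
  set s : ℝ := 1 ⬝ᵥ r with hs
  have hr_apply (i) : r i = ∑ j, A i j := by simp [hr, mulVec, dotProduct]
  have hle (i j) : A i j ≤ r i := by
    rw [hr_apply]
    exact single_le_sum (f := A i) (fun k _ ↦ hpos i k) (mem_univ j)
  have hr0 (i) : 0 ≤ r i := hr_apply i ▸ sum_nonneg fun j _ ↦ hpos i j
  have hsymm (i j) : A i j = A j i := (isHermitian_iff_isSymm.1 hA).apply j i
  have hs_eq : s = ∑ i, r i := by simp [hs, dotProduct]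
  have hs0 : 0 ≤ s := hs_eq ▸ sum_nonneg fun i _ ↦ hr0 i
  rcases hs0.eq_or_lt with hs0 | hs0
  · refine ⟨0, fun x _ ↦ ?_⟩
    have hzero (i j) : A i j = 0 := by
      have : r i = 0 := (sum_eq_zero_iff_of_nonneg fun i _ ↦ hr0 i).1 (hs_eq ▸ hs0.symm) i
        (mem_univ i)
      exact le_antisymm (this ▸ hle i j) (hpos i j)
    simp [dotProduct, mulVec, hzero, Real.zero_rpow h0.ne']
  set T : Matrix ι ι ℝ := of fun i j ↦ (r i)⁻¹ * (r i * r j - s * A i j) * (r j)⁻¹ with hTdef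
  have hT : T.PosSemidef := by
    refine .of_dotProduct_mulVec_nonneg ?_ fun x ↦ ?_
    · ext i j
      simp only [hTdef, conjTranspose_apply, of_apply, star_trivial, hsymm j i]
      ring
    · have h := hA.mul_le_sq_of_nonpos_of_dotProduct_eq_zero hu (fun i ↦ (r i)⁻¹ * x i) (w := 1) hs0
      have : star x ⬝ᵥ T *ᵥ x = ((fun i ↦ (r i)⁻¹ * x i) ⬝ᵥ r) ^ 2
          - ((fun i ↦ (r i)⁻¹ * x i) ⬝ᵥ A *ᵥ fun i ↦ (r i)⁻¹ * x i) * s := by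
        simp only [dotProduct, mulVec, hTdef, of_apply, star_trivial, sq, mul_sum,
          sum_mul, ← sum_sub_distrib]
        exact sum_congr rfl fun i _ ↦ sum_congr rfl fun j _ ↦ by ring
      rw [this]
      exact sub_nonneg.2 h
  have hT_le (i j) : T i j ≤ 1 := by
    have hi := hr0 i
    have hj := hr0 j
    have : T i j = (r i)⁻¹ * r i * (r j * (r j)⁻¹) - s * A i j * ((r i)⁻¹ * (r j)⁻¹) := by
      simp only [hTdef, of_apply]
      ring
    rw [this]
    have h₁ : 0 ≤ s * A i j * ((r i)⁻¹ * (r j)⁻¹) := by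
      have := hpos i j
      positivity
    have h₂ : (r i)⁻¹ * r i * (r j * (r j)⁻¹) ≤ 1 :=
      mul_le_one₀ inv_mul_le_one (by positivity) mul_inv_le_one
    linarith
  have hT1 (i j) : |T i j| ≤ 1 := by
    refine abs_le.2 ⟨?_, hT_le i j⟩
    have h := hT.dotProduct_mulVec_nonneg (Pi.single i 1 + Pi.single j 1)
    have hTs : T j i = T i j := (isHermitian_iff_isSymm.1 hT.isHermitian).apply i j
    simp [mulVec_add, add_dotProduct, dotProduct_add, hTs] at h
    linarith [hT_le i i, hT_le j j]
  have hentry (i j) : s ^ α * A i j ^ α = r i ^ α * r j ^ α * (1 - T i j) ^ α := by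
    have hi := hr0 i
    have hj := hr0 j
    have h1T : 0 ≤ 1 - T i j := sub_nonneg.2 (hT_le i j)
    rw [← Real.mul_rpow hs0.le (hpos i j), ← Real.mul_rpow hi hj,
      ← Real.mul_rpow (by positivity) h1T]
    congr 1
    rcases hi.eq_or_lt with hi | hi
    · simp [← hi, le_antisymm (hi ▸ hle i j) (hpos i j)]
    rcases hj.eq_or_lt with hj | hj
    · simp [← hj, hsymm i j, le_antisymm (hj ▸ hle j i) (hpos j i)]
    simp only [hTdef, of_apply]
    field_simp
    ring
  refine ⟨fun i ↦ r i ^ α, fun x hx ↦ ?_⟩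
  have h := hT.sum_one_sub_one_sub_rpow_nonneg hT1 h0 h1 fun i ↦ r i ^ α * x i
  have hsα : 0 < s ^ α := Real.rpow_pos_of_pos hs0 α
  refine nonpos_of_mul_nonpos_right ?_ hsα
  have key : s ^ α * (x ⬝ᵥ (of fun i j ↦ A i j ^ α : Matrix ι ι ℝ) *ᵥ x)
      = ((fun i ↦ r i ^ α) ⬝ᵥ x) ^ 2
        - ∑ i, ∑ j, r i ^ α * x i * (r j ^ α * x j) * (1 - (1 - T i j) ^ α) := by
    simp only [dotProduct, mulVec, of_apply, sq, sum_mul_sum]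
    simp only [mul_sum, ← sum_sub_distrib]
    refine sum_congr rfl fun i _ ↦ sum_congr rfl fun j _ ↦ ?_
    linear_combination x i * x j * hentry i j
  rw [key, hx]
  linarith

/-- a real symmetric matrix with nonnegative entries and at most one
positive eigenvalue keeps at most one positive eigenvalue after taking entrywise
powers with exponent `α ∈ [0,1]`. -/
theorem entrywise_pow_one_pos_eigenvalue (n : ℕ) (A : Matrix (Fin n) (Fin n) ℝ)
    (hA : A.IsHermitian) (hpos : ∀ i j, 0 ≤ A i j)
    (α : ℝ) (hα0 : 0 ≤ α) (hα1 : α ≤ 1)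
    (hcount : (Finset.univ.filter fun i => 0 < hA.eigenvalues i).card ≤ 1)
    (hB : (Matrix.of fun i j => (A i j) ^ α : Matrix (Fin n) (Fin n) ℝ).IsHermitian) :
    (Finset.univ.filter fun i => 0 < hB.eigenvalues i).card ≤ 1 := by
  obtain ⟨u, hu⟩ := hA.card_pos_eigenvalues_le_one_iff.1 hcount
  refine hB.card_pos_eigenvalues_le_one_iff.2 ?_
  rcases hα0.eq_or_lt with rfl | hα0
  · refine ⟨1, fun x hx ↦ le_of_eq ?_⟩
    rw [one_dotProduct] at hx
    simp [dotProduct, Matrix.mulVec, hx]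
  · exact hA.exists_forall_dotProduct_rpow_mulVec_nonpos hpos hu hα0 hα1
end

section
/- Let ν : 2^[n] → ℝ₊ be γ-weakly submodular with γ ≥ 0. Then the randomized double greedy algorithm (Algorithm with thresholds a_i, b_i including the additive (n−i)γ correction) returns a set X_n with E[ν(X_n)] ≥ (1/2)ν(OPT) − (3/16)n(n−1)γ, where OPT maximizes ν over all subsets. -/
open Finset MeasureTheory

/-- One run of the randomized double greedy algorithm with additive `(n−i)γ`
corrections, driven by the uniform random numbers `u : Fin n → ℝ`: `dgStep` is
the pair `(X_i, Y_i)` after `i` steps (element `i` of `Fin n` is processed at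
step `i + 1`; the branch adding `i` to `X` is taken with probability
`a/(a+b)`, i.e. when `u i · (a + b) < a`, so that `a = b = 0` takes the
remove branch). -/
noncomputable def dgStep (n : ℕ) (ν : Finset (Fin n) → ℝ) (γ : ℝ) (u : Fin n → ℝ) :
    ℕ → Finset (Fin n) × Finset (Fin n)
  | 0 => (∅, Finset.univ)
  | (i + 1) =>
    let P := dgStep n ν γ u i
    if h : i < n then
      let e : Fin n := ⟨i, h⟩
      let a := max (ν (insert e P.1) - ν P.1 + ((n : ℝ) - (i + 1)) * γ) 0
      let b := max (ν (P.2.erase e) - ν P.2 + ((n : ℝ) - (i + 1)) * γ) 0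
      if u e * (a + b) < a then (insert e P.1, P.2) else (P.1, P.2.erase e)
    else P

/-- One step of the double greedy algorithm at the element `e`, with additive correction `δ` and
random number `t`, from the pair `P = (X, Y)`. -/
noncomputable def dgUpdate {α : Type*} [DecidableEq α] (ν : Finset α → ℝ) (δ : ℝ) (e : α) (t : ℝ)
    (P : Finset α × Finset α) : Finset α × Finset α :=
  let a := max (ν (insert e P.1) - ν P.1 + δ) 0
  let b := max (ν (P.2.erase e) - ν P.2 + δ) 0
  if t * (a + b) < a then (insert e P.1, P.2) else (P.1, P.2.erase e)

theorem dgStep_succ {n : ℕ} (ν : Finset (Fin n) → ℝ) (γ : ℝ) (u : Fin n → ℝ) {i : ℕ} (h : i < n) :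
    dgStep n ν γ u (i + 1) =
      dgUpdate ν (((n : ℝ) - (i + 1)) * γ) ⟨i, h⟩ (u ⟨i, h⟩) (dgStep n ν γ u i) := by
  simp [dgStep, dgUpdate, h]

theorem dgStep_update {n : ℕ} (ν : Finset (Fin n) → ℝ) (γ : ℝ) (u : Fin n → ℝ) (e : Fin n) (t : ℝ)
    {i : ℕ} (h : i ≤ e) : dgStep n ν γ (Function.update u e t) i = dgStep n ν γ u i := by
  induction i with
  | zero => rfl
  | succ i ih =>
    have hi : i < n := by omega
    have hne : (⟨i, hi⟩ : Fin n) ≠ e := by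
      intro he
      have := congrArg Fin.val he
      simp only at this
      omega
    rw [dgStep_succ _ _ _ hi, dgStep_succ _ _ _ hi, ih (by omega), Function.update_of_ne hne]

/-- After `i` steps, `X` and `Y` agree on the processed elements, and every unprocessed element is
in `Y` but not in `X`. -/
theorem dgStep_mem {n : ℕ} (ν : Finset (Fin n) → ℝ) (γ : ℝ) (u : Fin n → ℝ) {i : ℕ} (h : i ≤ n)
    (j : Fin n) :
    (i ≤ j → j ∉ (dgStep n ν γ u i).1 ∧ j ∈ (dgStep n ν γ u i).2) ∧
      (j < i → (j ∈ (dgStep n ν γ u i).1 ↔ j ∈ (dgStep n ν γ u i).2)) := by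
  induction i with
  | zero => simp [dgStep]
  | succ i ih =>
    have hi : i < n := by omega
    have ih := ih hi.le
    rw [dgStep_succ _ _ _ hi]
    have hj : j = ⟨i, hi⟩ ↔ (j : ℕ) = i := Fin.ext_iff
    unfold dgUpdate
    dsimp only
    split_ifs <;> simp only [mem_insert, mem_erase, ne_eq, hj] <;> grind

theorem measurable_comp_dgStep {n : ℕ} (ν : Finset (Fin n) → ℝ) (γ : ℝ)
    {i : ℕ} (h : i ≤ n) (F : Finset (Fin n) × Finset (Fin n) → ℝ) :
    Measurable fun u => F (dgStep n ν γ u i) := by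
  induction i generalizing F with
  | zero => simp only [dgStep, measurable_const]
  | succ i ih =>
    have ih := ih (by omega)
    simp only [dgStep_succ ν γ _ (show i < n by omega), dgUpdate, apply_ite F]
    refine Measurable.ite (measurableSet_lt ((measurable_pi_apply _).mul ?_) ?_) ?_ ?_
    · exact ih fun P => max (ν (insert _ P.1) - ν P.1 + _) 0 + max (ν (P.2.erase _) - ν P.2 + _) 0
    · exact ih fun P => max (ν (insert _ P.1) - ν P.1 + _) 0
    · exact ih fun P => F (insert _ P.1, P.2)
    · exact ih fun P => F (P.1, P.2.erase _)

theorem integrable_comp_dgStep {n : ℕ} (ν : Finset (Fin n) → ℝ) (γ : ℝ)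
    (μ : Measure (Fin n → ℝ)) [IsFiniteMeasure μ]
    {i : ℕ} (h : i ≤ n) (F : Finset (Fin n) × Finset (Fin n) → ℝ) :
    Integrable (fun u => F (dgStep n ν γ u i)) μ :=
  Integrable.of_bound (measurable_comp_dgStep ν γ h F).aestronglyMeasurable (∑ P, ‖F P‖)
    (.of_forall fun _ => Finset.single_le_sum (f := fun P => ‖F P‖)
      (fun _ _ => norm_nonneg _) (Finset.mem_univ _))

/-- Resampling one coordinate preserves a product of probability measures. -/
theorem measurePreserving_update {ι : Type*} [Fintype ι] [DecidableEq ι] {X : ι → Type*}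
    [∀ i, MeasurableSpace (X i)] (μ : ∀ i, Measure (X i)) [∀ i, IsProbabilityMeasure (μ i)]
    (e : ι) :
    MeasurePreserving (fun p : (∀ i, X i) × X e => Function.update p.1 e p.2)
      ((Measure.pi μ).prod (μ e)) (Measure.pi μ) := by
  have hm : Measurable fun p : (∀ i, X i) × X e => Function.update p.1 e p.2 := by
    refine measurable_pi_iff.2 fun j => ?_
    by_cases hj : j = e
    · subst hj
      simpa using measurable_snd
    · simp only [Function.update_of_ne hj]
      exact (measurable_pi_apply j).comp measurable_fst
  refine ⟨hm, (Measure.pi_eq fun s hs => ?_).symm⟩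
  have hpre : (fun p : (∀ i, X i) × X e => Function.update p.1 e p.2) ⁻¹' Set.pi Set.univ s =
      Set.pi Set.univ (Function.update s e Set.univ) ×ˢ s e := by
    ext ⟨x, t⟩
    simp only [Set.mem_preimage, Set.mem_pi, Set.mem_univ, true_implies, Set.mem_prod]
    constructor
    · refine fun H => ⟨fun j => ?_, by simpa using H e⟩
      by_cases hj : j = e
      · subst hj
        simp
      · simpa [Function.update_of_ne hj] using H j
    · rintro ⟨H, ht⟩ j
      by_cases hj : j = e
      · subst hj
        simpa using ht
      · simpa [Function.update_of_ne hj] using H j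
  rw [Measure.map_apply hm (.univ_pi hs), hpre, Measure.prod_prod, Measure.pi_pi,
    ← Finset.mul_prod_erase _ _ (Finset.mem_univ e),
    ← Finset.mul_prod_erase (Finset.univ) (fun i => μ i (s i)) (Finset.mem_univ e),
    Function.update_self, measure_univ, one_mul, mul_comm]
  congr 1
  exact Finset.prod_congr rfl fun j hj => by rw [Function.update_of_ne (Finset.ne_of_mem_erase hj)]

theorem setIntegral_Icc_ite {c : ℝ} (hc0 : 0 ≤ c) (hc1 : c ≤ 1) (x y : ℝ) :
    ∫ t in Set.Icc (0 : ℝ) 1, (if t < c then x else y) = c * x + (1 - c) * y := by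
  have hx : ∫ t in Set.Ico 0 c, (if t < c then x else y) = c * x := by
    rw [setIntegral_congr_fun measurableSet_Ico (g := fun _ => x) fun t ht => if_pos ht.2]
    simp [hc0]
  have hy : ∫ t in Set.Icc c 1, (if t < c then x else y) = (1 - c) * y := by
    rw [setIntegral_congr_fun measurableSet_Icc (g := fun _ => y) fun t ht => if_neg ht.1.not_gt]
    simp [hc1]
  have hint (s : Set ℝ) (hs : volume s ≠ ⊤) :
      IntegrableOn (fun t => if t < c then x else y) s := by
    have : IsFiniteMeasure (volume.restrict s) := ⟨by simpa using hs.lt_top⟩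
    refine Integrable.of_bound (C := max ‖x‖ ‖y‖) (Measurable.ite measurableSet_Iio
      measurable_const measurable_const).aestronglyMeasurable (.of_forall fun t => ?_)
    split_ifs
    · exact le_max_left _ _
    · exact le_max_right _ _
  rw [← Set.Ico_union_Icc_eq_Icc hc0 hc1, setIntegral_union (Set.disjoint_left.2 fun t ht ht' =>
    ht'.1.not_gt ht.2) measurableSet_Icc (hint _ (by simp)) (hint _ (by simp)), hx, hy]

/-- The expectation of a function of a double greedy choice with weights `a`, `b`. -/
theorem setIntegral_Icc_weighted_choice {a b : ℝ} (ha : 0 ≤ a) (hb : 0 ≤ b) (x y : ℝ) :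
    ∫ t in Set.Icc (0 : ℝ) 1, (if t * (a + b) < a then x else y) =
      a / (a + b) * x + (1 - a / (a + b)) * y := by
  rw [← setIntegral_Icc_ite (div_nonneg ha (add_nonneg ha hb))
    (div_le_one_of_le₀ (by linarith) (by linarith))]
  refine setIntegral_congr_fun measurableSet_Icc fun t ht => ?_
  rcases (add_nonneg ha hb).eq_or_lt with h | h
  · have h0 : a = 0 := by linarith
    have h1 : b = 0 := by linarith
    simp [h0, h1, ht.1.not_gt]
  · simp only [lt_div_iff₀ h]

/-- Weak submodularity between a set and a superset. -/
theorem weakSubmodular_marginal_le {α : Type*} [DecidableEq α] {ν : Finset α → ℝ} {γ : ℝ}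
    (hws : ∀ (S : Finset α) (i j : α), i ∉ S → j ∉ S → i ≠ j →
      ν S + ν (insert i (insert j S)) ≤ γ + ν (insert i S) + ν (insert j S))
    {S T : Finset α} (hST : S ⊆ T) {e : α} (he : e ∉ T) :
    ν S + ν (insert e T) ≤ #(T \ S) * γ + ν (insert e S) + ν T := by
  have key (D : Finset α) : Disjoint S D → e ∉ S ∪ D →
      ν S + ν (insert e (S ∪ D)) ≤ #D * γ + ν (insert e S) + ν (S ∪ D) := by
    induction D using Finset.induction_on with
    | empty => simp [add_comm]
    | insert j D hj ih =>
      intro hd he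
      rw [Finset.disjoint_insert_right] at hd
      simp only [union_insert, mem_insert, not_or] at he ⊢
      have := ih hd.2 he.2
      have := hws (S ∪ D) e j he.2 (by simp [hd.1, hj]) he.1
      rw [card_insert_of_notMem hj]
      push_cast
      linarith
  have := key (T \ S) disjoint_sdiff (by rwa [union_sdiff_of_subset hST])
  rwa [union_sdiff_of_subset hST] at this

theorem double_greedy_choice_le {a' b' δ x y : ℝ} (hδ : 0 ≤ δ) (hab : -δ ≤ a' + b')
    (hxy : (x ≤ b' + δ ∧ y ≤ 0) ∨ (x ≤ 0 ∧ y ≤ a' + δ)) :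
    let a := max (a' + δ) 0
    let b := max (b' + δ) 0
    0 ≤ a / (a + b) * (a' - 2 * x) + (1 - a / (a + b)) * (b' - 2 * y) + δ := by
  intro a b
  have ha : 0 ≤ a := le_max_right _ _
  have hb : 0 ≤ b := le_max_right _ _
  have hxy' : (x ≤ b ∧ y ≤ 0) ∨ (x ≤ 0 ∧ y ≤ a) :=
    hxy.imp (And.imp_left fun h => h.trans (le_max_left _ _))
      (And.imp_right fun h => h.trans (le_max_left _ _))
  have hy : y ≤ a := by rcases hxy' with h | h <;> linarith
  have hx : x ≤ b := by rcases hxy' with h | h <;> linarith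
  rcases le_or_gt (a' + δ) 0 with h1 | h1
  · have : a = 0 := max_eq_right h1
    simp only [this, zero_div, zero_mul, sub_zero, one_mul, zero_add]
    linarith
  have ea : a = a' + δ := max_eq_left h1.le
  rcases le_or_gt (b' + δ) 0 with h2 | h2
  · have hb0 : b = 0 := max_eq_right h2
    rw [hb0, add_zero, div_self (by linarith)]
    linarith
  have eb : b = b' + δ := max_eq_left h2.le
  have hs : 0 < a + b := by linarith
  have hform : a / (a + b) * (a' - 2 * x) + (1 - a / (a + b)) * (b' - 2 * y) + δ =
      (a * (a - 2 * x) + b * (b - 2 * y)) / (a + b) := by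
    rw [show a' = a - δ by linarith, show b' = b - δ by linarith]
    field_simp
    ring
  rw [hform]
  refine div_nonneg ?_ hs.le
  rcases hxy' with ⟨h, h'⟩ | ⟨h, h'⟩
  · nlinarith [sq_nonneg (a - b), mul_le_mul_of_nonneg_left h ha, mul_le_mul_of_nonneg_left h' hb]
  · nlinarith [sq_nonneg (a - b), mul_le_mul_of_nonneg_left h ha, mul_le_mul_of_nonneg_left h' hb]

/-- The potential `2ν((O ∪ X) ∩ Y) + ν(X) + ν(Y)` of a state of the double greedy algorithm. -/
def dgPotential {α : Type*} [DecidableEq α] (ν : Finset α → ℝ) (O : Finset α)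
    (P : Finset α × Finset α) : ℝ :=
  2 * ν ((O ∪ P.1) ∩ P.2) + ν P.1 + ν P.2

/-- In expectation, one step of the algorithm decreases the potential by at most `δ`. -/
theorem dgPotential_sub_le_setIntegral {α : Type*} [DecidableEq α] {ν : Finset α → ℝ} {γ : ℝ}
    (hγ : 0 ≤ γ)
    (hws : ∀ (S : Finset α) (i j : α), i ∉ S → j ∉ S → i ≠ j →
      ν S + ν (insert i (insert j S)) ≤ γ + ν (insert i S) + ν (insert j S))
    (O : Finset α) {P : Finset α × Finset α} (hP : P.1 ⊆ P.2) {e : α} (he1 : e ∉ P.1)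
    (he2 : e ∈ P.2) {δ : ℝ} (hδ : #(P.2.erase e \ P.1) * γ ≤ δ) :
    dgPotential ν O P - δ ≤
      ∫ t in Set.Icc (0 : ℝ) 1, dgPotential ν O (dgUpdate ν δ e t P) := by
  obtain ⟨X, Y⟩ := P
  dsimp only at hP he1 he2 hδ
  have hXY : X ⊆ Y.erase e := subset_erase.2 ⟨hP, he1⟩
  have heY : e ∉ Y.erase e := notMem_erase e Y
  set Q := ((O ∪ X) ∩ Y).erase e with hQ
  have hXQ : X ⊆ Q := by grind
  have hQY : Q ⊆ Y.erase e := by grind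
  have heQ : e ∉ Q := notMem_erase _ _
  have hle {S T : Finset α} (hS : X ⊆ S) (hST : S ⊆ T) (hT : T ⊆ Y.erase e) :
      ν S + ν (insert e T) ≤ δ + ν (insert e S) + ν T := by
    have hcard : (#(T \ S) : ℝ) ≤ #(Y.erase e \ X) := by
      exact_mod_cast card_le_card (sdiff_subset_sdiff hT hS)
    have := weakSubmodular_marginal_le hws hST fun h => heY (hT h)
    have := mul_le_mul_of_nonneg_right hcard hγ
    linarith
  have h1 := hle subset_rfl hXY subset_rfl
  have h2 := hle subset_rfl hXQ hQY
  have h3 := hle hXQ hQY subset_rfl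
  rw [insert_erase he2] at h1 h3
  have hadd : (O ∪ insert e X) ∩ Y = insert e Q := by grind
  have hrem : (O ∪ X) ∩ Y.erase e = Q := by grind
  have hδ0 : 0 ≤ δ := (mul_nonneg (Nat.cast_nonneg _) hγ).trans hδ
  simp only [dgUpdate, apply_ite (dgPotential ν O)]
  rw [setIntegral_Icc_weighted_choice (le_max_right _ _) (le_max_right _ _)]
  have hchoice := double_greedy_choice_le (a' := ν (insert e X) - ν X)
    (b' := ν (Y.erase e) - ν Y) (x := ν ((O ∪ X) ∩ Y) - ν (insert e Q))
    (y := ν ((O ∪ X) ∩ Y) - ν Q) hδ0 (by linarith) (by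
      by_cases heO : e ∈ O
      · right
        rw [show (O ∪ X) ∩ Y = insert e Q by grind]
        constructor <;> linarith
      · left
        rw [show (O ∪ X) ∩ Y = Q by grind]
        constructor <;> linarith)
  simp only [dgPotential, hadd, hrem] at hchoice ⊢
  linarith

theorem dgPotential_sub_le_integral_succ {n : ℕ} {ν : Finset (Fin n) → ℝ} {γ : ℝ} (hγ : 0 ≤ γ)
    (hws : ∀ (S : Finset (Fin n)) (i j : Fin n), i ∉ S → j ∉ S → i ≠ j →
      ν S + ν (insert i (insert j S)) ≤ γ + ν (insert i S) + ν (insert j S))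
    (O : Finset (Fin n)) (μ : Fin n → Measure ℝ)
    (hμ : μ = fun _ => volume.restrict (Set.Icc (0 : ℝ) 1)) {i : ℕ} (h : i < n) :
    ∫ u, dgPotential ν O (dgStep n ν γ u i) ∂Measure.pi μ - ((n : ℝ) - (i + 1)) * γ ≤
      ∫ u, dgPotential ν O (dgStep n ν γ u (i + 1)) ∂Measure.pi μ := by
  have hprob (j : Fin n) : IsProbabilityMeasure (μ j) := ⟨by simp [hμ]⟩
  let e : Fin n := ⟨i, h⟩
  have hmp := measurePreserving_update μ e
  have hint : Integrable (fun p : (Fin n → ℝ) × ℝ =>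
      dgPotential ν O (dgStep n ν γ (Function.update p.1 e p.2) (i + 1)))
      ((Measure.pi μ).prod (μ e)) := hmp.integrable_comp_of_integrable
    (integrable_comp_dgStep ν γ (Measure.pi μ) (i := i + 1) h (dgPotential ν O))
  rw [← hmp.map_eq, integral_map hmp.measurable.aemeasurable
    (measurable_comp_dgStep ν γ h _).aestronglyMeasurable, hmp.map_eq, integral_prod _ hint]
  have hconst : ((n : ℝ) - (i + 1)) * γ = ∫ _, ((n : ℝ) - (i + 1)) * γ ∂Measure.pi μ := by simp
  have hI := integrable_comp_dgStep ν γ (Measure.pi μ) h.le (dgPotential ν O)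
  rw [hconst, ← integral_sub hI (integrable_const _)]
  refine integral_mono (hI.sub (integrable_const _)) hint.integral_prod_left fun u => ?_
  have hmem := dgStep_mem ν γ u h.le
  simp only [dgStep_succ ν γ _ h, dgStep_update ν γ u e _ (le_refl i), Function.update_self, e, hμ]
  refine dgPotential_sub_le_setIntegral hγ hws O (fun j hj => ?_) (hmem e |>.1 le_rfl).1
    (hmem e |>.1 le_rfl).2 ?_
  · rcases lt_or_ge (j : ℕ) i with hji | hji
    · exact ((hmem j).2 hji).1 hj
    · exact ((hmem j).1 hji).2
  · refine mul_le_mul_of_nonneg_right ?_ hγ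
    have hsub : (dgStep n ν γ u i).2.erase e \ (dgStep n ν γ u i).1 ⊆ Finset.Ioi e := by
      intro j hj
      rw [mem_sdiff, mem_erase] at hj
      rw [Finset.mem_Ioi]
      by_contra hje
      have hlt : j < e := lt_of_le_of_ne (not_lt.1 hje) hj.1.1
      exact hj.2 (((hmem j).2 hlt).2 hj.1.2)
    have hcard := card_le_card hsub
    rw [Fin.card_Ioi] at hcard
    have : #((dgStep n ν γ u i).2.erase e \ (dgStep n ν γ u i).1) + (i + 1) ≤ n := by
      simp only [e] at hcard ⊢
      omega
    rw [le_sub_iff_add_le]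
    exact_mod_cast this

/-- the randomized double greedy algorithm applied to a nonnegative
`γ`-weakly submodular function returns `X_n` with
`E[ν(X_n)] ≥ (1/2)·ν(OPT) − (3/16)·n(n−1)·γ`, the expectation being over the
`n` independent uniform random numbers in `[0,1]`. -/
theorem double_greedy_expectation_guarantee (n : ℕ) (ν : Finset (Fin n) → ℝ)
    (hν0 : ∀ S, 0 ≤ ν S) (γ : ℝ) (hγ : 0 ≤ γ)
    (hws : ∀ (S : Finset (Fin n)) (i j : Fin n), i ∉ S → j ∉ S → i ≠ j →
      ν S + ν (insert i (insert j S)) ≤ γ + ν (insert i S) + ν (insert j S))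
    (OPT : Finset (Fin n)) (hOPT : ∀ T : Finset (Fin n), ν T ≤ ν OPT) :
    (1 / 2) * ν OPT - (3 / 16) * (n : ℝ) * ((n : ℝ) - 1) * γ ≤
      ∫ u : Fin n → ℝ, ν ((dgStep n ν γ u n).1)
        ∂(Measure.pi fun _ : Fin n => volume.restrict (Set.Icc (0 : ℝ) 1)) := by
  generalize hμ : (fun _ : Fin n => volume.restrict (Set.Icc (0 : ℝ) 1)) = μ
  have hprob (j : Fin n) : IsProbabilityMeasure (μ j) := ⟨by simp [← hμ]⟩
  have hstep : ∀ i ≤ n, 2 * ν OPT - ((n : ℝ) * i - i * (i + 1) / 2) * γ ≤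
      ∫ u, dgPotential ν OPT (dgStep n ν γ u i) ∂Measure.pi μ := by
    intro i hi
    induction i with
    | zero =>
      simp only [dgStep, dgPotential, integral_const, smul_eq_mul, union_empty, inter_univ]
      rw [probReal_univ]
      have := hν0 ∅
      have := hν0 univ
      push_cast
      linarith
    | succ i ih =>
      have := ih (by omega)
      have := dgPotential_sub_le_integral_succ hγ hws OPT μ hμ.symm (show i < n from hi)
      push_cast
      linarith
  have hfinal (u : Fin n → ℝ) :
      dgPotential ν OPT (dgStep n ν γ u n) = 4 * ν (dgStep n ν γ u n).1 := by
    have hXY : (dgStep n ν γ u n).1 = (dgStep n ν γ u n).2 := by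
      ext j
      exact (dgStep_mem ν γ u le_rfl j).2 j.2
    rw [dgPotential, ← hXY, inter_eq_right.2 subset_union_right]
    ring
  have h := hstep n le_rfl
  simp only [hfinal, integral_const_mul] at h
  have hn : 0 ≤ (n : ℝ) * (n - 1) * γ := by
    refine mul_nonneg ?_ hγ
    rcases n.eq_zero_or_pos with h0 | h0
    · simp [h0]
    · have : (1 : ℝ) ≤ n := by exact_mod_cast h0
      exact mul_nonneg (by linarith) (by linarith)
  nlinarith
end
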